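/- Let k ≥ 1, let L ≥ 2, and let A ∈ ℂ^{L×N} be a matrix that is injective on k-sparse vectors (i.e., if x and z are k-sparse and Ax = Az then x = z). Define the measurement vectors φ_{s,l} := A*ψ_{s,l} ∈ ℂ^N for s = 1,…,4 and l = 1,…,L−1, where ψ_{1,l} = α·e_1 + β·e_{l+1}, ψ_{2,l} = β·e_1 + α·e_{l+1}, ψ_{3,l} = α·e_1 − β·e_{l+1}, ψ_{4,l} = −β·e_1 + α·e_{l+1}, and A* is the conjugate transpose of A. Then for all k-sparse x, z ∈ ℂ^N with (Ax)[1] ≠ 0, if |⟨x, φ_{s,l}⟩|² = |⟨z, φ_{s,l}⟩|² for all s = 1,…,4 and l = 1,…,L−1, then there exists c ∈ ℂ with |c| = 1 such that z = c·x. -/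

import Mathlib

/-- The inner product on `ℂ^n`: `⟨x, y⟩ = ∑ i, x[i] · conj(y[i])`. -/
noncomputable def cinner {n : ℕ} (x y : Fin n → ℂ) : ℂ :=
  ∑ i, x i * (starRingEnd ℂ) (y i)

/-- A vector `x ∈ ℂ^N` is `k`-sparse if it has at most `k` nonzero entries. -/
def IsSparse {N : ℕ} (k : ℕ) (x : Fin N → ℂ) : Prop :=
  (Finset.univ.filter fun n => x n ≠ 0).card ≤ k

/-- The constant `α = √((1 − 1/√3)/2)`. -/
noncomputable def alphaPR : ℝ := Real.sqrt ((1 - 1 / Real.sqrt 3) / 2)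

/-- The constant `β = e^{−i5π/4} · √((1 + 1/√3)/2)`. -/
noncomputable def betaPR : ℂ :=
  Complex.exp (-(Complex.I * (5 * Real.pi / 4))) *
    (Real.sqrt ((1 + 1 / Real.sqrt 3) / 2) : ℝ)

/-- The measurement vectors `ψ_{s,l} ∈ ℂ^L`:
`ψ_{1,l} = α e_1 + β e_{l+1}`, `ψ_{2,l} = β e_1 + α e_{l+1}`,
`ψ_{3,l} = α e_1 − β e_{l+1}`, `ψ_{4,l} = −β e_1 + α e_{l+1}`. -/
noncomputable def psiPR {L : ℕ} (s : Fin 4) (l : Fin (L - 1)) : Fin L → ℂ :=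
  (![(alphaPR : ℂ), betaPR, (alphaPR : ℂ), -betaPR] s) •
      (Pi.single (⟨0, by have := l.isLt; omega⟩ : Fin L) 1 : Fin L → ℂ)
    + (![betaPR, (alphaPR : ℂ), -betaPR, (alphaPR : ℂ)] s) •
      (Pi.single (⟨l.val + 1, by have := l.isLt; omega⟩ : Fin L) 1 : Fin L → ℂ)

lemma alphaPR_pos : 0 < alphaPR := by
  have h3 : 1 < Real.sqrt 3 := by
    rw [Real.lt_sqrt] <;> norm_num
  have h : 1 / Real.sqrt 3 < 1 := (div_lt_one (by linarith)).2 h3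
  exact Real.sqrt_pos.2 (by linarith)

/-- `betaPR` is a positive real multiple of `-1 + i`, of modulus different from `alphaPR`. -/
lemma exists_betaPR_eq :
    ∃ t : ℝ, 0 < t ∧ alphaPR ^ 2 < 2 * t ^ 2 ∧ betaPR.re = -t ∧ betaPR.im = t := by
  have h3 : 1 < Real.sqrt 3 := by
    rw [Real.lt_sqrt] <;> norm_num
  have h0 : 0 < 1 / Real.sqrt 3 := by positivity
  have h1 : 1 / Real.sqrt 3 < 1 := (div_lt_one (by linarith)).2 h3
  have hexp : Complex.exp (-(Complex.I * (5 * Real.pi / 4))) =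
      ((-(Real.sqrt 2 / 2) : ℝ) : ℂ) + ((Real.sqrt 2 / 2 : ℝ) : ℂ) * Complex.I := by
    have e : -(Complex.I * (5 * (Real.pi : ℂ) / 4)) =
        ((-(Real.pi / 4 + Real.pi) : ℝ) : ℂ) * Complex.I := by
      push_cast; ring
    rw [e, Complex.exp_mul_I, ← Complex.ofReal_cos, ← Complex.ofReal_sin, Real.cos_neg,
      Real.sin_neg, Real.cos_add_pi, Real.sin_add_pi, Real.cos_pi_div_four,
      Real.sin_pi_div_four, neg_neg]
  refine ⟨Real.sqrt 2 / 2 * Real.sqrt ((1 + 1 / Real.sqrt 3) / 2), by positivity, ?_, ?_, ?_⟩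
  · rw [alphaPR, mul_pow, div_pow, Real.sq_sqrt (by linarith), Real.sq_sqrt (by linarith),
      Real.sq_sqrt (by linarith)]
    linarith
  · rw [betaPR, hexp, Complex.re_mul_ofReal]
    simp
  · rw [betaPR, hexp, Complex.im_mul_ofReal]
    simp

/-- The four intensities determine the modulus of the first component and the relative phase. -/
lemma norm_eq_and_mul_conj_eq_of_intensities {a t : ℝ} {b : ℂ} (ha : 0 < a) (ht : 0 < t)
    (hat : a ^ 2 < 2 * t ^ 2) (hre : b.re = -t) (him : b.im = t) {u v u' v' : ℂ}
    (h1 : ‖u * a + v * (starRingEnd ℂ) b‖ ^ 2 = ‖u' * a + v' * (starRingEnd ℂ) b‖ ^ 2)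
    (h2 : ‖u * (starRingEnd ℂ) b + v * a‖ ^ 2 = ‖u' * (starRingEnd ℂ) b + v' * a‖ ^ 2)
    (h3 : ‖u * a + v * (starRingEnd ℂ) (-b)‖ ^ 2 = ‖u' * a + v' * (starRingEnd ℂ) (-b)‖ ^ 2)
    (h4 : ‖u * (starRingEnd ℂ) (-b) + v * a‖ ^ 2 = ‖u' * (starRingEnd ℂ) (-b) + v' * a‖ ^ 2) :
    ‖u‖ = ‖u'‖ ∧ u * (starRingEnd ℂ) v = u' * (starRingEnd ℂ) v' := by
  rw [← sq_eq_sq₀ (norm_nonneg _) (norm_nonneg _)]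
  simp only [← Complex.normSq_eq_norm_sq, Complex.normSq_apply, Complex.add_re, Complex.add_im,
    Complex.mul_re, Complex.mul_im, Complex.conj_re, Complex.conj_im, Complex.neg_re,
    Complex.neg_im, Complex.ofReal_re, Complex.ofReal_im, Complex.ext_iff, hre, him]
    at h1 h2 h3 h4 ⊢
  have hat' : 4 * t ^ 4 - a ^ 4 ≠ 0 := by nlinarith [sq_nonneg a, sq_pos_of_pos ha]
  have h8at : 8 * (a * t) ≠ 0 := by positivity
  refine ⟨?_, ?_, ?_⟩
  · apply mul_left_cancel₀ hat'
    linear_combination (-a ^ 2 / 2) * (h1 + h3) + t ^ 2 * (h2 + h4)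
  · apply mul_left_cancel₀ h8at
    linear_combination (-1 : ℝ) * (h1 - h3) - (h2 - h4)
  · apply mul_left_cancel₀ h8at
    linear_combination (-1 : ℝ) * (h1 - h3) + (h2 - h4)

/-- `⟨x, A* y⟩ = ⟨A x, y⟩`. -/
lemma cinner_conjTranspose_mulVec {L N : ℕ} (A : Matrix (Fin L) (Fin N) ℂ) (x : Fin N → ℂ)
    (y : Fin L → ℂ) : cinner x (A.conjTranspose.mulVec y) = cinner (A.mulVec x) y := by
  simp only [cinner, Matrix.mulVec, dotProduct, Matrix.conjTranspose_apply, map_sum, map_mul,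
    Finset.mul_sum, Finset.sum_mul]
  rw [Finset.sum_comm]
  refine Finset.sum_congr rfl fun i _ => Finset.sum_congr rfl fun j _ => ?_
  simp only [RCLike.star_def, Complex.conj_conj]
  ring

lemma cinner_smul_single_add_smul_single {L : ℕ} (y : Fin L → ℂ) (i j : Fin L) (c d : ℂ) :
    cinner y (c • (Pi.single i 1 : Fin L → ℂ) + d • (Pi.single j 1 : Fin L → ℂ)) =
      y i * (starRingEnd ℂ) c + y j * (starRingEnd ℂ) d := by
  simp [cinner, Pi.single_apply, mul_add, Finset.sum_add_distrib, apply_ite (starRingEnd ℂ)]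

lemma IsSparse.smul {N k : ℕ} {x : Fin N → ℂ} (hx : IsSparse k x) (c : ℂ) :
    IsSparse k (c • x) := by
  refine (Finset.card_le_card fun n hn => ?_).trans hx
  simp only [Finset.mem_filter, Finset.mem_univ, true_and, Pi.smul_apply, smul_eq_mul] at hn ⊢
  exact right_ne_zero_of_mul hn

/-- If `A` is injective on `k`-sparse vectors, then with the measurement vectors
`φ_{s,l} = A* ψ_{s,l}`, every `k`-sparse `x` with `(Ax)[1] ≠ 0` is determined, up to a
unimodular factor, by the intensities `|⟨x, φ_{s,l}⟩|²`. -/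
theorem sparse_phase_retrieval_psi_measurements
    (N L k : ℕ) (hk : 1 ≤ k) (hL : 2 ≤ L)
    (A : Matrix (Fin L) (Fin N) ℂ)
    (hA : ∀ x z : Fin N → ℂ, IsSparse k x → IsSparse k z →
      A.mulVec x = A.mulVec z → x = z)
    (φ : Fin 4 → Fin (L - 1) → (Fin N → ℂ))
    (hφ : ∀ s l, φ s l = A.conjTranspose.mulVec (psiPR s l))
    (x z : Fin N → ℂ) (hx : IsSparse k x) (hz : IsSparse k z)
    (hx1 : A.mulVec x ⟨0, by omega⟩ ≠ 0)
    (h : ∀ (s : Fin 4) (l : Fin (L - 1)),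
      ‖cinner x (φ s l)‖ ^ 2 = ‖cinner z (φ s l)‖ ^ 2) :
    ∃ c : ℂ, ‖c‖ = 1 ∧ z = c • x := by
  obtain ⟨t, ht, hat, hre, him⟩ := exists_betaPR_eq
  have key (l : Fin (L - 1)) := by
    have h1 := h 0 l
    have h2 := h 1 l
    have h3 := h 2 l
    have h4 := h 3 l
    simp only [hφ, cinner_conjTranspose_mulVec, psiPR, cinner_smul_single_add_smul_single]
      at h1 h2 h3 h4
    simp only [Matrix.cons_val, Complex.conj_ofReal] at h1 h2 h3 h4
    exact norm_eq_and_mul_conj_eq_of_intensities alphaPR_pos ht hat hre him h1 h2 h3 h4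
  set u := A.mulVec x ⟨0, by omega⟩ with hu
  set u' := A.mulVec z ⟨0, by omega⟩ with hu'
  have hnorm : ‖u‖ = ‖u'‖ := (key ⟨0, by omega⟩).1
  have hu'0 : u' ≠ 0 := norm_ne_zero_iff.1 (hnorm ▸ norm_ne_zero_iff.2 hx1)
  have hc : ‖u' / u‖ = 1 := by
    rw [norm_div, hnorm, div_self (norm_ne_zero_iff.2 hu'0)]
  refine ⟨u' / u, hc, hA _ _ hz (hx.smul _) ?_⟩
  rw [Matrix.mulVec_smul]
  funext i
  rw [Pi.smul_apply, smul_eq_mul]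
  obtain ⟨_ | m, hm⟩ := i
  · exact (div_mul_cancel₀ u' hx1).symm
  · have hw : u * (starRingEnd ℂ) (A.mulVec x ⟨m + 1, hm⟩) =
        u' * (starRingEnd ℂ) (A.mulVec z ⟨m + 1, hm⟩) := (key ⟨m, by omega⟩).2
    have hsq : u * (starRingEnd ℂ) u = u' * (starRingEnd ℂ) u' := by
      rw [Complex.mul_conj', Complex.mul_conj', hnorm]
    have hw' := congrArg (starRingEnd ℂ) hw
    simp only [map_mul, Complex.conj_conj] at hw'
    have hcu' : (starRingEnd ℂ) u' ≠ 0 := (map_ne_zero _).2 hu'0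
    rw [div_mul_eq_mul_div, eq_div_iff hx1]
    apply mul_left_cancel₀ hcu'
    linear_combination (-u) * hw' + A.mulVec x ⟨m + 1, hm⟩ * hsq
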